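/- For every real c with 1/21 < c < 1/12, set a = (3 − 18c + √(3(−1 + 24c − 36c²)))/18 and b = (3 − √(3(−1 + 24c − 36c²)))/18. Then the 9×9 diagonal matrix diag(a, a, a, b, b, b, c, c, c) is an extreme point of AP_{3,3}. -/

import Mathlib

open Matrix ComplexOrder

noncomputable section

/-- Index type for a two-qutrit system. -/
abbrev QIdx : Type := Fin 3 × Fin 3

/-- Partial transpose: `PT M ((i,j),(k,l)) = M ((i,l),(k,j))`. -/
def PT (M : Matrix QIdx QIdx ℂ) : Matrix QIdx QIdx ℂ :=
  fun p q => M (p.1, q.2) (q.1, p.2)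

/-- The set of absolutely PPT two-qutrit states. -/
def AP33 : Set (Matrix QIdx QIdx ℂ) :=
  {ρ | ρ.PosSemidef ∧ ρ.trace = 1 ∧
    ∀ U : Matrix QIdx QIdx ℂ, U ∈ Matrix.unitaryGroup QIdx ℂ →
      (PT (U * ρ * Uᴴ)).PosSemidef}

/-- The 9×9 diagonal matrix with prescribed real diagonal entries
(listed in order), regarded as a matrix indexed by `QIdx`. -/
def diag9 (d : Fin 9 → ℝ) : Matrix QIdx QIdx ℂ :=
  Matrix.diagonal fun p => ((d ((finProdFinEquiv.trans (finCongr (by norm_num))) p) : ℝ) : ℂ)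

theorem eigenvalue_relations (c : ℝ) (h1 : 1 / 21 < c) (h2 : c < 1 / 12) (a b : ℝ)
    (ha : a = (3 - 18 * c + Real.sqrt (3 * (-1 + 24 * c - 36 * c ^ 2))) / 18)
    (hb : b = (3 - Real.sqrt (3 * (-1 + 24 * c - 36 * c ^ 2))) / 18) :
    c < b ∧ b < a ∧ a ≤ b + c ∧ a + b + c = 1 / 3 ∧ b * (3 * c - a) = (a - b) ^ 2 := by
  have hs0 : 0 ≤ 3 * (-1 + 24 * c - 36 * c ^ 2) := by nlinarith
  have hs := Real.sq_sqrt hs0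
  have hsn := Real.sqrt_nonneg (3 * (-1 + 24 * c - 36 * c ^ 2))
  set s := Real.sqrt (3 * (-1 + 24 * c - 36 * c ^ 2))
  have u1 : s ≤ 18 * c := abs_le_of_sq_le_sq' (by nlinarith [sq_nonneg (12 * c - 1)]) (by linarith) |>.2
  have u2 : 9 * c < s := by
    refine lt_of_pow_lt_pow_left₀ 2 hsn ?_
    nlinarith
  have u3 : s < 3 - 18 * c := by
    refine lt_of_pow_lt_pow_left₀ 2 (by linarith) ?_
    nlinarith
  subst ha hb
  refine ⟨by linarith, by linarith, by linarith, by ring, ?_⟩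
  nlinarith

theorem weighted_sum_nonneg {a b c : ℝ} (hc : 0 < c) (hcb : c < b) (hba : b < a)
    (habc : a ≤ b + c) (hdet : b * (3 * c - a) = (a - b) ^ 2) {x y z : ℝ} (hx : 0 ≤ x)
    (hxy : x ≤ y) (hyz : y ≤ z) (A C : QIdx → ℝ) (hA : ∀ m, 0 ≤ A m) (hC : ∀ m, 0 ≤ C m)
    (hA1 : ∀ m, A m ≤ 1) (hC1 : ∀ m, C m ≤ 1)
    (hAs : ∑ m, A m = 3) (hCs : ∑ m, C m = 3)
    (ω : QIdx → ℝ)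
    (hω : ω = fun m =>
      !![-(y * z), -(x * z), -(x * y); x ^ 2, x * y, x * z; y * z, y ^ 2, z ^ 2] m.1 m.2) :
    0 ≤ ∑ m, ω m * (b + (a - b) * A m - (b - c) * C m) := by
  have hy : 0 ≤ y := hx.trans hxy
  have hz : 0 ≤ z := hy.trans hyz
  have key1 : -(y * z + x * z + x * y) ≤ ∑ m, ω m * A m := by
    have h : ∀ m, -(if m.1 = 0 then -(ω m + x * y) else 0) ≤ (ω m + x * y) * A m := by
      have e1 : x * y ≤ x * z := by gcongr
      have e2 : x * y ≤ y * z := by nlinarith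
      have e3 : 0 ≤ x * y := by positivity
      rintro ⟨i, j⟩
      have h0 := hA (i, j)
      have h1 := hA1 (i, j)
      subst hω
      fin_cases i <;> fin_cases j <;> simp at h0 h1 ⊢ <;> first | positivity | nlinarith
    have := Finset.sum_le_sum (s := Finset.univ) fun m _ => h m
    simp only [add_mul, Finset.sum_add_distrib, ← Finset.mul_sum, hAs] at this
    subst hω
    simp [Fintype.sum_prod_type, Fin.sum_univ_three] at this ⊢
    linarith
  have key2 : ∀ t, 0 ≤ t → t ≤ y * z → x ^ 2 ≤ t → x * y ≤ t → t ≤ z ^ 2 →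
      ∑ m, ω m * C m ≤ 3 * t + (y * z - t) + (z ^ 2 - t) + max 0 (x * z - t) + max 0 (y ^ 2 - t) := by
    intro t ht t1 t2 t3 t4
    have h : ∀ m, (ω m - t) * C m ≤ max 0 (ω m - t) := by
      intro m
      rcases le_total 0 (ω m - t) with h | h
      · rw [max_eq_right h]; nlinarith [hC1 m]
      · rw [max_eq_left h]; nlinarith [hC m]
    have := Finset.sum_le_sum (s := Finset.univ) fun m _ => h m
    simp only [sub_mul, Finset.sum_sub_distrib, ← Finset.mul_sum, hCs] at this
    have e1 : 0 ≤ y * z := by positivity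
    have e2 : 0 ≤ x * z := by positivity
    have e3 : 0 ≤ x * y := by positivity
    subst hω
    simp [Fintype.sum_prod_type, Fin.sum_univ_three] at this ⊢
    rw [max_eq_left (a := 0) (b := -(y * z) - t) (by linarith),
      max_eq_left (a := 0) (b := -(x * z) - t) (by linarith),
      max_eq_left (a := 0) (b := -(x * y) - t) (by linarith),
      max_eq_left (a := 0) (b := x ^ 2 - t) (by linarith),
      max_eq_left (a := 0) (b := x * y - t) (by linarith),
      max_eq_right (a := 0) (b := y * z - t) (by linarith),
      max_eq_right (a := 0) (b := z ^ 2 - t) (by linarith)] at this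
    linarith
  have expand : ∑ m, ω m * (b + (a - b) * A m - (b - c) * C m)
      = b * (x ^ 2 + y ^ 2 + z ^ 2) + (a - b) * ∑ m, ω m * A m - (b - c) * ∑ m, ω m * C m := by
    have : ∑ m, ω m = x ^ 2 + y ^ 2 + z ^ 2 := by
      subst hω
      simp [Fintype.sum_prod_type, Fin.sum_univ_three]
      ring
    rw [← this, Finset.mul_sum, Finset.mul_sum, Finset.mul_sum, ← Finset.sum_add_distrib,
      ← Finset.sum_sub_distrib]
    exact Finset.sum_congr rfl fun m _ => by ring
  rw [expand]
  have hb : 0 < b := hc.trans hcb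
  have k1 := mul_le_mul_of_nonneg_left key1 (sub_nonneg.2 hba.le)
  have hcb' := sub_nonneg.2 hcb.le
  rcases le_total (x * z) (y ^ 2) with h | h
  · have k2 := key2 (y ^ 2) (by positivity) (by nlinarith) (by nlinarith) (by nlinarith)
      (by nlinarith)
    rw [max_eq_left (sub_nonpos.2 h), sub_self, max_self] at k2
    have k3 := mul_le_mul_of_nonneg_left k2 hcb'
    have : 0 ≤ c * (y ^ 2 + z ^ 2) + b * x ^ 2 + (c - a) * (y * z) - (a - b) * (y + z) * x := by
      refine nonneg_of_mul_nonneg_right (a := b) ?_ hb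
      have : b * (c * (y ^ 2 + z ^ 2) + b * x ^ 2 + (c - a) * (y * z) - (a - b) * (y + z) * x)
        = ((a - b) * (y + z) / 2 - b * x) ^ 2 + b * (c + a) * (y - z) ^ 2 / 4 := by
        linear_combination (y + z) ^ 2 / 4 * hdet
      rw [this]
      have : 0 < c + a := by linarith
      positivity
    linarith
  · have k2 := key2 (x * z) (by positivity) (by nlinarith) (by nlinarith) (by nlinarith)
      (by nlinarith)
    rw [max_eq_left (sub_nonpos.2 h), sub_self, max_self] at k2
    have k3 := mul_le_mul_of_nonneg_left k2 hcb'
    have : 0 ≤ c * z ^ 2 + b * (x ^ 2 + y ^ 2) + (c - a) * z * (x + y) + (b - a) * (x * y) := by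
      refine nonneg_of_mul_nonneg_right (a := c) ?_ hc
      have : c * (c * z ^ 2 + b * (x ^ 2 + y ^ 2) + (c - a) * z * (x + y) + (b - a) * (x * y))
        = ((a - c) * (x + y) / 2 - c * z) ^ 2 + c * (b + a) * (x - y) ^ 2 / 4
          + (b - c) * (b + c - a) * (x + y) ^ 2 / 4 := by
        linear_combination (x + y) ^ 2 / 4 * hdet
      rw [this]
      have : 0 < b + a := by linarith
      have : 0 ≤ b + c - a := by linarith
      positivity
    linarith
theorem OrthonormalBasis.matrix_mem_unitaryGroup {n : Type*} [Fintype n] [DecidableEq n]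
    (e : OrthonormalBasis n ℂ (EuclideanSpace ℂ n)) :
    (Matrix.of fun i j => e j i) ∈ Matrix.unitaryGroup n ℂ := by
  rw [Matrix.mem_unitaryGroup_iff']
  ext i j
  have := (orthonormal_iff_ite.1 e.orthonormal) i j
  simpa [Matrix.mul_apply, Matrix.one_apply, PiLp.inner_apply, mul_comm] using this

theorem Matrix.exists_svd {n : ℕ} (M : Matrix (Fin n) (Fin n) ℂ) :
    ∃ A ∈ unitaryGroup (Fin n) ℂ, ∃ B ∈ unitaryGroup (Fin n) ℂ, ∃ p : Fin n → ℝ,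
      Monotone p ∧ 0 ≤ p ∧ M = A * diagonal (fun i => (p i : ℂ)) * B := by
  have hH : (Mᴴ * M).IsHermitian := isHermitian_conjTranspose_mul_self M
  let q : Fin n → ℝ := fun i => ‖M.toEuclideanLin (hH.eigenvectorBasis i)‖
  let e := hH.eigenvectorBasis.reindex (Tuple.sort q).symm
  let f : Fin n → EuclideanSpace ℂ (Fin n) := fun i => M.toEuclideanLin (e i)
  have hf : Pairwise fun i j => inner ℂ (f i) (f j) = 0 := by
    intro i j hij
    have h1 : ∀ v w : EuclideanSpace ℂ (Fin n), inner ℂ (M.toEuclideanLin v) (M.toEuclideanLin w)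
        = inner ℂ v ((Mᴴ * M).toEuclideanLin w) := by
      intro v w
      rw [← LinearMap.adjoint_inner_right, ← Matrix.toEuclideanLin_conjTranspose_eq_adjoint]
      simp [Matrix.toLpLin_apply, Matrix.mulVec_mulVec]
    have h2 : (Mᴴ * M).toEuclideanLin (e j) = (hH.eigenvalues (Tuple.sort q j) : ℂ) • e j := by
      ext k
      have := congrFun (hH.mulVec_eigenvectorBasis (Tuple.sort q j)) k
      simpa [e, Matrix.toLpLin_apply] using this
    simp only [f]
    rw [h1, h2, inner_smul_right, orthonormal_iff_ite.1 e.orthonormal, if_neg hij, mul_zero]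
  let a := InnerProductSpace.gramSchmidtOrthonormalBasis (𝕜 := ℂ) (by simp) f
  have ha : ∀ i, f i = (‖f i‖ : ℂ) • a i := by
    intro i
    by_cases h : f i = 0
    · simp [h]
    · rw [InnerProductSpace.gramSchmidtOrthonormalBasis_apply_of_orthogonal _ hf h, smul_smul]
      have h2 : (‖f i‖ : ℂ) ≠ 0 := by simpa using h
      exact (by rw [mul_inv_cancel₀ h2, one_smul] : f i = ((‖f i‖ : ℂ) * (‖f i‖ : ℂ)⁻¹) • f i)
  refine ⟨_, a.matrix_mem_unitaryGroup, _,
    Unitary.star_mem e.matrix_mem_unitaryGroup, fun i => ‖f i‖, ?_, fun i => norm_nonneg _, ?_⟩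
  · have := Tuple.monotone_sort q
    intro i j hij
    simpa [q, f, e, Function.comp_def] using this hij
  · have h : M * (Matrix.of fun i j => e j i)
        = (Matrix.of fun i j => a j i) * diagonal (fun i => (‖f i‖ : ℂ)) := by
      ext i j
      rw [Matrix.mul_diagonal]
      have := congrArg (fun v => v i) (ha j)
      simpa [f, Matrix.toLpLin_apply, Matrix.mul_apply, Matrix.mulVec, dotProduct,
        mul_comm] using this
    rw [← h, Matrix.mul_assoc, mem_unitaryGroup_iff.1 e.matrix_mem_unitaryGroup, Matrix.mul_one]

theorem eq_zero_of_phase_sum_eq_zero {n : Type*} [Fintype n] [DecidableEq n] (G : Matrix n n ℂ)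
    (h : ∀ φ : n → ℂ, (∀ i, star (φ i) * φ i = 1) → φ ⬝ᵥ G *ᵥ star φ = 0) :
    (∀ i j, i ≠ j → G i j = 0) ∧ ∑ i, G i i = 0 := by
  have row : ∀ i, ∀ u : n → ℂ, u i = 0 → (∀ j, j ≠ i → star (u j) * u j = 1) →
      (G *ᵥ star u) i = 0 := by
    intro i u hu hu1
    have key : ∀ z : ℂ, star z * z = 1 →
        u ⬝ᵥ G *ᵥ star u + star z * (u ⬝ᵥ G *ᵥ Pi.single i 1) + z * (G *ᵥ star u) i + G i i = 0 := by
      intro z hz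
      have := h (u + z • Pi.single i 1) (by
        intro j
        by_cases hj : j = i
        · subst hj; simpa [hu] using hz
        · simpa [hj] using hu1 j hj)
      have hs : star (u + z • Pi.single i 1 : n → ℂ) = star u + star z • Pi.single i 1 := by
        ext j
        by_cases hj : j = i
        · subst hj; simp
        · simp [hj]
      rw [hs] at this
      simp only [Matrix.mulVec_add, Matrix.mulVec_smul, dotProduct_add, add_dotProduct,
        smul_dotProduct, dotProduct_smul, single_one_dotProduct, smul_eq_mul] at this
      have hi : (G *ᵥ Pi.single i 1) i = G i i := by simp
      rw [hi] at this
      linear_combination this - G i i * hz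
    have e1 := key 1 (by simp)
    have e2 := key (-1) (by simp)
    have e3 := key Complex.I (by simp)
    have e4 := key (-Complex.I) (by simp)
    simp at e1 e2 e3 e4
    linear_combination (e1 - e2) / 4 - Complex.I * (e3 - e4) / 4
      - (u ⬝ᵥ G.col i - (G *ᵥ star u) i) / 2 * Complex.I_sq
  have off : ∀ i j, i ≠ j → G i j = 0 := by
    intro i j hij
    have key : ∀ w : ℂ, star w * w = 1 →
        (G *ᵥ star (fun k => if k = i ∨ k = j then 0 else 1 : n → ℂ)) i + star w * G i j = 0 := by
      intro w hw
      have := row i ((fun k => if k = i ∨ k = j then 0 else 1) + w • Pi.single j 1)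
        (by simp [hij]) (by
          intro k hk
          by_cases hkj : k = j
          · subst hkj; simpa using hw
          · simp [hk, hkj])
      have hs : star ((fun k => if k = i ∨ k = j then 0 else 1) + w • Pi.single j 1 : n → ℂ)
          = star (fun k => if k = i ∨ k = j then 0 else 1) + star w • Pi.single j 1 := by
        ext k
        by_cases hj : k = j
        · subst hj; simp
        · simp [hj]
      rw [hs] at this
      simpa [Matrix.mulVec_add, Matrix.mulVec_smul] using this
    have e1 := key 1 (by simp)
    have e2 := key (-1) (by simp)
    simp only [star_one, star_neg] at e1 e2
    linear_combination (e1 - e2) / 2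
  refine ⟨off, ?_⟩
  have := h 1 (by simp)
  simp only [dotProduct, Matrix.mulVec, Pi.one_apply, one_mul, star_one, mul_one] at this
  rw [← this]
  refine Finset.sum_congr rfl fun i _ => ?_
  rw [Finset.sum_eq_single i (fun j _ hj => off i j hj.symm) (by simp)]

theorem PT_isHermitian {M : Matrix QIdx QIdx ℂ} (hM : M.IsHermitian) : (PT M).IsHermitian := by
  ext p q
  exact hM.apply _ _

theorem dotProduct_PT_mulVec_local (A B : Matrix (Fin 3) (Fin 3) ℂ) (p : Fin 3 → ℝ)
    (X : Matrix QIdx QIdx ℂ) (v : QIdx → ℂ)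
    (hv : ∀ i j, v (i, j) = (A * diagonal (fun i => (p i : ℂ)) * B) i j) :
    star v ⬝ᵥ PT X *ᵥ v =
      ∑ s, ∑ t, (p s * p t : ℂ) * ((kroneckerMap (· * ·) A Bᴴ)ᴴ * X * kroneckerMap (· * ·) A Bᴴ) (s, t) (t, s) := by
  have hv' : v = fun x => ∑ s, A x.1 s * p s * B s x.2 := by
    ext ⟨i, j⟩
    rw [hv, Matrix.mul_apply]
    simp [Matrix.mul_diagonal]
  subst hv'
  simp only [dotProduct, Matrix.mulVec, Matrix.mul_apply, Fintype.sum_prod_type, PT, Pi.star_apply,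
    star_sum, star_mul', Finset.mul_sum, Finset.sum_mul, conjTranspose_apply, kroneckerMap_apply,
    Complex.star_def, Complex.conj_ofReal, Complex.conj_conj]
  simp only [← Fintype.sum_prod_type']
  exact Fintype.sum_equiv
    ⟨fun x => (x.2.2.2.2.2, x.2.2.2.2.1, x.2.2.1, x.2.1, x.1, x.2.2.2.1),
      fun y => (y.2.2.2.2.1, y.2.2.2.1, y.2.2.1, y.2.2.2.2.2, y.2.1, y.1),
      fun _ => rfl, fun _ => rfl⟩ _ _ fun x => by simp only [Equiv.coe_fn_mk]; ring

/-- The orthonormal basis of `ℂ³ ⊗ ℂ³` made of the antisymmetric vectors, then `|00⟩` and the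
symmetric vectors involving `|0⟩`, then the remaining symmetric vectors; vectors are written as
`3 × 3` matrices, with `r` standing for `1 / √2`. -/
def swapVec (r : ℝ) : Fin 3 → Fin 3 → Matrix (Fin 3) (Fin 3) ℝ
  | 0, 0 => !![0, 0, 0; 0, 0, r; 0, -r, 0]
  | 0, 1 => !![0, 0, r; 0, 0, 0; -r, 0, 0]
  | 0, 2 => !![0, r, 0; -r, 0, 0; 0, 0, 0]
  | 1, 0 => !![1, 0, 0; 0, 0, 0; 0, 0, 0]
  | 1, 1 => !![0, r, 0; r, 0, 0; 0, 0, 0]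
  | 1, 2 => !![0, 0, r; 0, 0, 0; r, 0, 0]
  | 2, 0 => !![0, 0, 0; 0, 0, r; 0, r, 0]
  | 2, 1 => !![0, 0, 0; 0, 1, 0; 0, 0, 0]
  | 2, 2 => !![0, 0, 0; 0, 0, 0; 0, 0, 1]

/-- The unitary matrix whose columns are the vectors `swapVec`. -/
def swapBasis : Matrix QIdx QIdx ℂ := fun x m => (swapVec (√2)⁻¹ m.1 m.2 x.1 x.2 : ℂ)

theorem inv_sqrt_two_mul_self : (√2)⁻¹ * (√2)⁻¹ = (1 / 2 : ℝ) := by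
  rw [← mul_inv, Real.mul_self_sqrt (by norm_num)]
  norm_num

theorem swapVec_orthonormal {r : ℝ} (hr : r * r = 1 / 2) (i j s t : Fin 3) :
    ∑ k, ∑ l, swapVec r i j k l * swapVec r s t k l = if i = s ∧ j = t then 1 else 0 := by
  fin_cases i <;> fin_cases j <;> fin_cases s <;> fin_cases t <;>
    simp [Fin.sum_univ_three, swapVec, hr] <;> norm_num

theorem swapBasis_mem_unitaryGroup : swapBasis ∈ Matrix.unitaryGroup QIdx ℂ := by
  rw [Matrix.mem_unitaryGroup_iff']
  ext ⟨i, j⟩ ⟨s, t⟩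
  simp only [Matrix.mul_apply, Matrix.star_apply, Fintype.sum_prod_type, swapBasis]
  have := swapVec_orthonormal inv_sqrt_two_mul_self i j s t
  simp only [Matrix.one_apply, Prod.mk.injEq]
  rw [← Complex.ofReal_inj] at this
  push_cast at this
  simpa [apply_ite Complex.ofReal] using this

/-- The eigenvalues of `X ↦ ∑ pₛ pₜ X (s,t) (t,s)` in the basis `swapVec`. -/
def swapWeight (p : Fin 3 → ℝ) (m : QIdx) : ℝ :=
  !![-(p 1 * p 2), -(p 0 * p 2), -(p 0 * p 1); p 0 ^ 2, p 0 * p 1, p 0 * p 2;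
    p 1 * p 2, p 1 ^ 2, p 2 ^ 2] m.1 m.2

theorem sum_swap_eq (p : Fin 3 → ℝ) (X : Matrix QIdx QIdx ℂ) :
    ∑ s, ∑ t, (p s * p t : ℂ) * X (s, t) (t, s)
      = ∑ m, (swapWeight p m : ℂ) * (star swapBasis * X * swapBasis) m m := by
  have hr := inv_sqrt_two_mul_self
  simp only [Matrix.mul_apply, Matrix.star_apply, Fintype.sum_prod_type,
    Fin.sum_univ_three, swapBasis, swapWeight]
  generalize (√2)⁻¹ = r at hr
  rw [← Complex.ofReal_inj] at hr
  simp [swapVec] at hr ⊢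
  linear_combination (-2) * (p 1 * p 2 * (X (1, 2) (2, 1) + X (2, 1) (1, 2))
    + p 0 * p 2 * (X (0, 2) (2, 0) + X (2, 0) (0, 2))
    + p 0 * p 1 * (X (0, 1) (1, 0) + X (1, 0) (0, 1))) * hr

theorem sum_swap_nonneg {a b c : ℝ} (hc : 0 < c) (hcb : c < b) (hba : b < a)
    (habc : a ≤ b + c) (hdet : b * (3 * c - a) = (a - b) ^ 2) {p : Fin 3 → ℝ}
    (hp : Monotone p) (hp0 : 0 ≤ p) {V : Matrix QIdx QIdx ℂ} (hV : V ∈ unitaryGroup QIdx ℂ) :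
    0 ≤ ∑ s, ∑ t, (p s * p t : ℂ) *
      (V * diagonal (fun m : QIdx => ((![a, b, c] m.1 : ℝ) : ℂ)) * star V) (s, t) (t, s) := by
  rw [sum_swap_eq]
  let R := star swapBasis * V
  have hR : R ∈ unitaryGroup QIdx ℂ :=
    mul_mem (Unitary.star_mem swapBasis_mem_unitaryGroup) hV
  have hrow : ∀ m, ∑ n, Complex.normSq (R m n) = 1 := by
    intro m
    have := congrFun₂ (mem_unitaryGroup_iff.1 hR) m m
    simp only [Matrix.mul_apply, star_apply, one_apply_eq, Complex.star_def, Complex.mul_conj] at this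
    exact_mod_cast this
  have hcol : ∀ n, ∑ m, Complex.normSq (R m n) = 1 := by
    intro m
    have := congrFun₂ (mem_unitaryGroup_iff'.1 hR) m m
    simp only [Matrix.mul_apply, star_apply, one_apply_eq, Complex.star_def,
      ← Complex.normSq_eq_conj_mul_self] at this
    exact_mod_cast this
  let α : Fin 3 → QIdx → ℝ := fun i m => ∑ j, Complex.normSq (R m (i, j))
  have hα0 : ∀ i m, 0 ≤ α i m := fun i m => Finset.sum_nonneg fun _ _ => Complex.normSq_nonneg _
  have hα1 : ∀ m, α 0 m + α 1 m + α 2 m = 1 := by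
    intro m
    rw [← hrow m, Fintype.sum_prod_type, Fin.sum_univ_three]
  have hα3 : ∀ i, ∑ m, α i m = 3 := by
    intro i
    simp only [α]
    rw [Finset.sum_comm]
    simp [hcol]
  have key := weighted_sum_nonneg hc hcb hba habc hdet (hp0 0) (hp (by decide : (0 : Fin 3) ≤ 1))
    (hp (by decide : (1 : Fin 3) ≤ 2)) (α 0) (α 2) (hα0 0) (hα0 2)
    (fun m => by linarith [hα1 m, hα0 1 m, hα0 2 m])
    (fun m => by linarith [hα1 m, hα0 0 m, hα0 1 m]) (hα3 0) (hα3 2) (swapWeight p) rfl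
  rw [← Complex.zero_le_real] at key
  refine key.trans_eq ?_
  rw [Complex.ofReal_sum]
  refine Finset.sum_congr rfl fun m _ => ?_
  rw [Complex.ofReal_mul]
  congr 1
  have : star swapBasis * (V * diagonal (fun m : QIdx => ((![a, b, c] m.1 : ℝ) : ℂ)) * star V)
      * swapBasis = R * diagonal (fun m : QIdx => ((![a, b, c] m.1 : ℝ) : ℂ)) * star R := by
    simp only [R, star_mul, star_star, Matrix.mul_assoc]
  rw [this, Matrix.mul_apply]
  have e : ∀ n : QIdx, (R * diagonal (fun m : QIdx => ((![a, b, c] m.1 : ℝ) : ℂ))) m n * star R n m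
      = ((![a, b, c] n.1 * Complex.normSq (R m n) : ℝ) : ℂ) := by
    intro n
    rw [Matrix.mul_diagonal, star_apply, Complex.star_def, Complex.ofReal_mul, ← Complex.mul_conj]
    ring
  rw [Finset.sum_congr rfl fun n _ => e n, ← Complex.ofReal_sum, Fintype.sum_prod_type]
  simp only [← Finset.mul_sum]
  rw [Fin.sum_univ_three]
  congr 1
  simp only [Matrix.cons_val]
  linear_combination (-b) * hα1 m

theorem diagonal_mem_AP33 {a b c : ℝ} (hc : 0 < c) (hcb : c < b) (hba : b < a)
    (habc : a ≤ b + c) (hsum : a + b + c = 1 / 3) (hdet : b * (3 * c - a) = (a - b) ^ 2) :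
    diagonal (fun m : QIdx => ((![a, b, c] m.1 : ℝ) : ℂ)) ∈ AP33 := by
  have hpos : (diagonal (fun m : QIdx => ((![a, b, c] m.1 : ℝ) : ℂ))).PosSemidef := by
    refine PosSemidef.diagonal fun m => ?_
    obtain ⟨i, j⟩ := m
    rw [Pi.zero_apply, Complex.zero_le_real]
    fin_cases i <;> simp <;> linarith
  refine ⟨hpos, ?_, fun U hU => ?_⟩
  · have := congrArg Complex.ofReal hsum
    push_cast at this
    simp [trace, Fintype.sum_prod_type, Fin.sum_univ_three]
    linear_combination 3 * this
  · refine PosSemidef.of_dotProduct_mulVec_nonneg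
      (PT_isHermitian (hpos.mul_mul_conjTranspose_same U).isHermitian) fun v => ?_
    obtain ⟨A, hA, B, hB, p, hp, hp0, hM⟩ := exists_svd (Matrix.of fun i j => v (i, j))
    rw [dotProduct_PT_mulVec_local A B p _ v fun i j => by rw [← hM]; rfl]
    have hF : kroneckerMap (· * ·) A Bᴴ ∈ unitaryGroup QIdx ℂ :=
      kronecker_mem_unitary hA (Unitary.star_mem hB)
    generalize kroneckerMap (· * ·) A Bᴴ = F at hF ⊢
    have h := sum_swap_nonneg hc hcb hba habc hdet hp hp0 (mul_mem (Unitary.star_mem hF) hU)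
    generalize diagonal (fun m : QIdx => ((![a, b, c] m.1 : ℝ) : ℂ)) = ρ at h ⊢
    have e : Fᴴ * (U * ρ * Uᴴ) * F = star F * U * ρ * star (star F * U) := by
      simp only [star_eq_conjTranspose, conjTranspose_mul, conjTranspose_conjTranspose,
        Matrix.mul_assoc]
    rw [e]
    exact h

theorem exists_swapVec_mul_ne_zero {r x y : ℝ} (hr : r * r = 1 / 2) (hx : x ≠ 0) (hy : y ≠ 0)
    (s t : Fin 3) : ∃ j l, (s, j) ≠ (t, l) ∧ ∃ i k,
      (swapVec r s j * diagonal ![x, y, y] * swapVec r t l) i k ≠ 0 := by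
  have hr0 : r ≠ 0 := by
    rintro rfl
    norm_num at hr
  have key : ∃ j l i k, (s, j) ≠ (t, l) ∧
      (swapVec r s j * diagonal ![x, y, y] * swapVec r t l) i k ≠ 0 := by
    fin_cases s <;> fin_cases t
    · exact ⟨0, 1, 1, 0, by decide, by
        simp [swapVec, mul_apply, Fin.sum_univ_three, vecMul_diagonal, hr0, hy]⟩
    · exact ⟨1, 2, 0, 0, by decide, by
        simp [swapVec, mul_apply, Fin.sum_univ_three, vecMul_diagonal, hr0, hy]⟩
    · exact ⟨0, 0, 1, 1, by decide, by
        simp [swapVec, mul_apply, Fin.sum_univ_three, vecMul_diagonal, hr0, hy]⟩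
    · exact ⟨2, 1, 0, 0, by decide, by
        simp [swapVec, mul_apply, Fin.sum_univ_three, vecMul_diagonal, hr0, hy]⟩
    · exact ⟨0, 1, 0, 1, by decide, by
        simp [swapVec, mul_apply, Fin.sum_univ_three, vecMul_diagonal, hr0, hx]⟩
    · exact ⟨1, 1, 0, 1, by decide, by
        simp [swapVec, mul_apply, Fin.sum_univ_three, vecMul_diagonal, hr0, hy]⟩
    · exact ⟨0, 0, 1, 1, by decide, by
        simp [swapVec, mul_apply, Fin.sum_univ_three, vecMul_diagonal, hr0, hy]⟩
    · exact ⟨1, 1, 1, 0, by decide, by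
        simp [swapVec, mul_apply, Fin.sum_univ_three, vecMul_diagonal, hr0, hy]⟩
    · exact ⟨0, 1, 2, 1, by decide, by
        simp [swapVec, mul_apply, Fin.sum_univ_three, vecMul_diagonal, hr0, hy]⟩
  obtain ⟨j, l, i, k, h⟩ := key
  exact ⟨j, l, h.1, i, k, h.2⟩

theorem exists_block_perm {s t a b a' b' : Fin 3} (h : (s, a) ≠ (t, b)) (h' : (s, a') ≠ (t, b')) :
    ∃ τ : Fin 3 → Equiv.Perm (Fin 3), τ s a = a' ∧ τ t b = b' := by
  by_cases hst : s = t
  · subst hst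
    have : ∀ a b a' b' : Fin 3, a ≠ b → a' ≠ b' → ∃ π : Equiv.Perm (Fin 3), π a = a' ∧ π b = b' := by
      decide
    obtain ⟨π, hπ⟩ := this a b a' b' (by simpa using h) (by simpa using h')
    exact ⟨fun _ => π, hπ⟩
  · exact ⟨fun u => if u = s then Equiv.swap a a' else Equiv.swap b b', by simp, by
      simp [Ne.symm hst]⟩

theorem swapVec_mul_zero_zero {r : ℝ} (hr : r * r = 1 / 2) (x y : ℝ) (s j : Fin 3) :
    (swapVec r s j * diagonal ![x, y, y] * swapVec r s j) 0 0
      = !![0, -y / 2, -y / 2; x, y / 2, y / 2; 0, 0, 0] s j := by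
  fin_cases s <;> fin_cases j <;> simp [swapVec, mul_apply, Fin.sum_univ_three, vecMul_diagonal] <;>
    first | linear_combination y * hr | linear_combination -y * hr

theorem swapVec_mul_one_one {r : ℝ} (hr : r * r = 1 / 2) (x y : ℝ) (s j : Fin 3) :
    (swapVec r s j * diagonal ![x, y, y] * swapVec r s j) 1 1
      = !![-y / 2, 0, -x / 2; 0, x / 2, 0; y / 2, y, 0] s j := by
  fin_cases s <;> fin_cases j <;> simp [swapVec, mul_apply, Fin.sum_univ_three, vecMul_diagonal] <;>
    first
    | linear_combination y * hr
    | linear_combination -y * hr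
    | linear_combination x * hr
    | linear_combination -x * hr

theorem sum_swapVec_mul_eq_zero {r : ℝ} (hr : r * r = 1 / 2) {a b c : ℝ}
    (hdet : b * (3 * c - a) = (a - b) ^ 2) (i k : Fin 3) :
    ∑ s, ![a, b, c] s * ∑ j, (swapVec r s j * diagonal ![a - b, b, b] * swapVec r s j) i k = 0 := by
  fin_cases i <;> fin_cases k <;> simp [swapVec, mul_apply, Fin.sum_univ_three]
  · linear_combination (2 * b * b - 2 * a * b) * hr
  · linear_combination (b * c - a * b - (a - b) * (a - b)) * hr + hdet / 2
  · linear_combination (b * c - a * b - (a - b) * (a - b)) * hr + hdet / 2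

/-- The basis `swapBasis` with its columns permuted within the three blocks and multiplied by
phases. -/
def blockBasis (τ : Fin 3 → Equiv.Perm (Fin 3)) (φ : QIdx → ℂ) : Matrix QIdx QIdx ℂ :=
  fun x m => swapBasis x (m.1, τ m.1 m.2) * φ m

theorem blockBasis_mem_unitaryGroup (τ : Fin 3 → Equiv.Perm (Fin 3)) {φ : QIdx → ℂ}
    (hφ : ∀ m, star (φ m) * φ m = 1) : blockBasis τ φ ∈ unitaryGroup QIdx ℂ := by
  rw [mem_unitaryGroup_iff']
  ext m n
  have h := congrFun₂ (mem_unitaryGroup_iff'.1 swapBasis_mem_unitaryGroup)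
    (m.1, τ m.1 m.2) (n.1, τ n.1 n.2)
  have e : (star (blockBasis τ φ) * blockBasis τ φ) m n = star (φ m) * φ n *
      (star swapBasis * swapBasis) (m.1, τ m.1 m.2) (n.1, τ n.1 n.2) := by
    simp only [mul_apply, star_apply, blockBasis, star_mul', Finset.mul_sum]
    exact Finset.sum_congr rfl fun x _ => by ring
  rw [e, h]
  by_cases hmn : m = n
  · subst hmn
    simpa using hφ m
  · have : (m.1, τ m.1 m.2) ≠ (n.1, τ n.1 n.2) := by
      obtain ⟨i, j⟩ := m
      obtain ⟨k, l⟩ := n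
      intro h
      rw [Prod.mk.injEq] at h
      obtain ⟨rfl, h⟩ := h
      exact hmn (Prod.ext rfl ((τ i).injective h))
    rw [one_apply_ne this, one_apply_ne hmn, mul_zero]

theorem PT_blockBasis_mulVec (τ : Fin 3 → Equiv.Perm (Fin 3)) (φ : QIdx → ℂ) (p : Fin 3 → ℝ)
    (X : Matrix QIdx QIdx ℂ) (i k : Fin 3) :
    (PT (blockBasis τ φ * X * (blockBasis τ φ)ᴴ) *ᵥ fun q => if q.1 = q.2 then (p q.1 : ℂ) else 0)
      (i, k) = φ ⬝ᵥ (Matrix.of fun m n => X m n * (((swapVec (√2)⁻¹ m.1 (τ m.1 m.2) * diagonal p *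
        swapVec (√2)⁻¹ n.1 (τ n.1 n.2)) i k : ℝ) : ℂ)) *ᵥ star φ := by
  have hsym : (PT (blockBasis τ φ * X * (blockBasis τ φ)ᴴ) *ᵥ
      fun q => if q.1 = q.2 then (p q.1 : ℂ) else 0) (i, k)
      = ∑ j, (blockBasis τ φ * X * (blockBasis τ φ)ᴴ) (i, j) (j, k) * p j := by
    simp [Matrix.mulVec, dotProduct, Fintype.sum_prod_type, PT]
  rw [hsym]
  simp only [dotProduct, Matrix.mulVec, mul_apply (M := _ * X), mul_apply (N := X),
    conjTranspose_apply, Finset.sum_mul, Finset.mul_sum, of_apply, mul_apply (N := swapVec _ _ _),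
    mul_diagonal, Complex.ofReal_sum]
  rw [Finset.sum_comm]
  rw [Finset.sum_congr rfl fun n _ => Finset.sum_comm]
  rw [Finset.sum_comm]
  refine Finset.sum_congr rfl fun m _ => Finset.sum_congr rfl fun n _ =>
    Finset.sum_congr rfl fun j _ => ?_
  simp only [blockBasis, star_mul', swapBasis, Pi.star_apply, Complex.star_def,
    Complex.conj_ofReal]
  push_cast
  ring

theorem PT_blockBasis_mulVec_eq_zero {a b c : ℝ} (hdet : b * (3 * c - a) = (a - b) ^ 2)
    (τ : Fin 3 → Equiv.Perm (Fin 3)) {φ : QIdx → ℂ} (hφ : ∀ m, star (φ m) * φ m = 1) :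
    (PT (blockBasis τ φ * diagonal (fun m : QIdx => ((![a, b, c] m.1 : ℝ) : ℂ)) *
      (blockBasis τ φ)ᴴ) *ᵥ fun q => if q.1 = q.2 then (![a - b, b, b] q.1 : ℂ) else 0) = 0 := by
  ext ⟨i, k⟩
  have h := PT_blockBasis_mulVec τ φ ![a - b, b, b]
    (diagonal (fun m : QIdx => ((![a, b, c] m.1 : ℝ) : ℂ))) i k
  have hv : (fun q : QIdx => if q.1 = q.2 then ((![a - b, b, b] q.1 : ℝ) : ℂ) else 0)
      = fun q => if q.1 = q.2 then (![a - b, b, b] q.1 : ℂ) else 0 := by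
    ext ⟨q, q'⟩
    fin_cases q <;> simp
  rw [hv] at h
  rw [h]
  have h0 := sum_swapVec_mul_eq_zero inv_sqrt_two_mul_self hdet i k
  have e : ∀ m n : QIdx, φ m * (diagonal (fun m : QIdx => ((![a, b, c] m.1 : ℝ) : ℂ)) m n *
      (((swapVec (√2)⁻¹ m.1 (τ m.1 m.2) * diagonal ![a - b, b, b] *
        swapVec (√2)⁻¹ n.1 (τ n.1 n.2)) i k : ℝ) : ℂ) * star (φ n)) = if n = m then
        ((![a, b, c] m.1 * (swapVec (√2)⁻¹ m.1 (τ m.1 m.2) * diagonal ![a - b, b, b] *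
        swapVec (√2)⁻¹ m.1 (τ m.1 m.2)) i k : ℝ) : ℂ) else 0 := by
    intro m n
    by_cases hmn : n = m
    · subst hmn
      rw [diagonal_apply_eq, if_pos rfl]
      push_cast
      linear_combination (((![a, b, c] n.1 : ℝ) : ℂ) * (((swapVec (√2)⁻¹ n.1 (τ n.1 n.2) *
        diagonal ![a - b, b, b] * swapVec (√2)⁻¹ n.1 (τ n.1 n.2)) i k : ℝ) : ℂ)) * hφ n
    · rw [if_neg hmn, diagonal_apply_ne _ (Ne.symm hmn)]
      ring
  simp only [dotProduct, Matrix.mulVec, of_apply, Pi.star_apply, Finset.mul_sum, e,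
    Finset.sum_ite_eq', Finset.mem_univ, if_true, Pi.zero_apply]
  rw [← Complex.ofReal_sum, ← Complex.ofReal_zero, Complex.ofReal_inj, ← h0, Fintype.sum_prod_type]
  refine Finset.sum_congr rfl fun s _ => ?_
  rw [Finset.mul_sum]
  exact Equiv.sum_comp (τ s) fun j => ![a, b, c] s *
    (swapVec (√2)⁻¹ s j * diagonal ![a - b, b, b] * swapVec (√2)⁻¹ s j) i k

theorem Matrix.PosSemidef.mulVec_eq_zero_of_add {n : Type*} [Fintype n] {P Q : Matrix n n ℂ}
    (hP : P.PosSemidef) (hQ : Q.PosSemidef) {s t : ℝ} (hs : 0 < s) (ht : 0 ≤ t) {v : n → ℂ}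
    (h : (s • P + t • Q) *ᵥ v = 0) : P *ᵥ v = 0 := by
  have h1 := hP.dotProduct_mulVec_nonneg v
  have h2 := hQ.dotProduct_mulVec_nonneg v
  have h3 := congrArg (star v ⬝ᵥ ·) h
  simp only [add_mulVec, smul_mulVec, dotProduct_add, dotProduct_smul, dotProduct_zero] at h3
  rw [← hP.dotProduct_mulVec_zero_iff]
  have h4 : s • (star v ⬝ᵥ P *ᵥ v) ≤ 0 := by
    rw [← h3]
    exact le_add_of_nonneg_right (smul_nonneg ht h2)
  have h5 := le_antisymm h4 (smul_nonneg hs.le h1)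
  exact (smul_eq_zero.1 h5).resolve_left hs.ne'

theorem eq_of_sum_swapVec_mul_eq_zero {x y : ℝ} (hx : x ≠ 0) (hy : y ≠ 0) (d : QIdx → ℂ)
    (h : ∀ (τ : Fin 3 → Equiv.Perm (Fin 3)) (i k : Fin 3), ∑ m : QIdx, d m *
      (((swapVec (√2)⁻¹ m.1 (τ m.1 m.2) * diagonal ![x, y, y] *
        swapVec (√2)⁻¹ m.1 (τ m.1 m.2)) i k : ℝ) : ℂ) = 0) :
    (∀ s j, d (s, j) = d (s, 0)) ∧ y * d (0, 0) = (x + y) * d (1, 0) ∧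
      (x + y) * d (0, 0) = x * d (1, 0) + 3 * y * d (2, 0) := by
  have hx' : (x : ℂ) ≠ 0 := by simpa using hx
  have hy' : (y : ℂ) ≠ 0 := by simpa using hy
  have h0 := fun τ => h τ 0 0
  have h1 := fun τ => h τ 1 1
  simp only [swapVec_mul_zero_zero inv_sqrt_two_mul_self,
    swapVec_mul_one_one inv_sqrt_two_mul_self, Fintype.sum_prod_type, Fin.sum_univ_three] at h0 h1
  have p0 := h0 1
  have p1 := h0 ![Equiv.swap 0 1, 1, 1]
  have p2 := h0 ![Equiv.swap 0 2, 1, 1]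
  have q0 := h1 1
  have q1 := h1 ![1, Equiv.swap 0 1, 1]
  have q2 := h1 ![1, Equiv.swap 1 2, 1]
  have q3 := h1 ![1, 1, Equiv.swap 0 2]
  have q4 := h1 ![1, 1, Equiv.swap 1 2]
  simp [Equiv.swap_apply_def] at p0 p1 p2 q0 q1 q2 q3 q4
  have e1 : d (0, 1) = d (0, 0) := mul_left_cancel₀ hy' (by linear_combination 2 * (p1 - p0))
  have e2 : d (0, 2) = d (0, 0) := mul_left_cancel₀ hy' (by linear_combination 2 * (p2 - p0))
  have e3 : d (1, 1) = d (1, 0) := mul_left_cancel₀ hx' (by linear_combination 2 * (q0 - q1))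
  have e4 : d (1, 2) = d (1, 1) := mul_left_cancel₀ hx' (by linear_combination 2 * (q2 - q0))
  have e5 : d (2, 2) = d (2, 0) := mul_left_cancel₀ hy' (by linear_combination 2 * (q3 - q0))
  have e6 : d (2, 1) = d (2, 2) := mul_left_cancel₀ hy' (by linear_combination (q0 - q4))
  rw [e3] at e4
  rw [e5] at e6
  refine ⟨?_, ?_, ?_⟩
  · intro s j
    fin_cases s <;> fin_cases j <;> simp [e1, e2, e3, e4, e5, e6]
  · rw [e1, e2, e4, e3] at p0
    linear_combination -p0
  · rw [e2, e3, e6] at q0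
    linear_combination -2 * q0

theorem diagonal_mem_extremePoints {a b c : ℝ} (hc : 0 < c) (hcb : c < b) (hba : b < a)
    (habc : a ≤ b + c) (hsum : a + b + c = 1 / 3) (hdet : b * (3 * c - a) = (a - b) ^ 2) :
    diagonal (fun m : QIdx => ((![a, b, c] m.1 : ℝ) : ℂ)) ∈ Set.extremePoints ℝ AP33 := by
  rw [mem_extremePoints_iff_left]
  refine ⟨diagonal_mem_AP33 hc hcb hba habc hsum hdet, ?_⟩
  rintro σ hσ σ' hσ' ⟨s, t, hs, ht, -, hρ⟩
  have hx : a - b ≠ 0 := (sub_pos.2 hba).ne'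
  have hy : b ≠ 0 := (hc.trans hcb).ne'
  have ker : ∀ (τ : Fin 3 → Equiv.Perm (Fin 3)) (i k : Fin 3),
      (∀ m n : QIdx, m ≠ n → σ m n * (((swapVec (√2)⁻¹ m.1 (τ m.1 m.2) *
        diagonal ![a - b, b, b] * swapVec (√2)⁻¹ n.1 (τ n.1 n.2)) i k : ℝ) : ℂ) = 0) ∧
      ∑ m : QIdx, σ m m * (((swapVec (√2)⁻¹ m.1 (τ m.1 m.2) *
        diagonal ![a - b, b, b] * swapVec (√2)⁻¹ m.1 (τ m.1 m.2)) i k : ℝ) : ℂ) = 0 := by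
    intro τ i k
    refine eq_zero_of_phase_sum_eq_zero (Matrix.of fun m n => σ m n *
      (((swapVec (√2)⁻¹ m.1 (τ m.1 m.2) * diagonal ![a - b, b, b] *
        swapVec (√2)⁻¹ n.1 (τ n.1 n.2)) i k : ℝ) : ℂ)) fun φ hφ => ?_
    rw [← PT_blockBasis_mulVec]
    have hU := blockBasis_mem_unitaryGroup τ hφ
    have h0 := PT_blockBasis_mulVec_eq_zero hdet τ hφ
    rw [← hρ] at h0
    have e : PT (blockBasis τ φ * (s • σ + t • σ') * (blockBasis τ φ)ᴴ)
        = s • PT (blockBasis τ φ * σ * (blockBasis τ φ)ᴴ)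
          + t • PT (blockBasis τ φ * σ' * (blockBasis τ φ)ᴴ) := by
      simp only [Matrix.mul_add, Matrix.add_mul, Matrix.mul_smul, Matrix.smul_mul]
      rfl
    rw [e] at h0
    exact congrFun ((hσ.2.2 _ hU).mulVec_eq_zero_of_add (hσ'.2.2 _ hU) hs ht.le h0) (i, k)
  have off : ∀ m n, m ≠ n → σ m n = 0 := by
    rintro ⟨u, j⟩ ⟨w, l⟩ hmn
    obtain ⟨j', l', hne, i, k, h⟩ :=
      exists_swapVec_mul_ne_zero inv_sqrt_two_mul_self hx hy u w
    obtain ⟨τ, rfl, rfl⟩ := exists_block_perm hmn hne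
    exact (mul_eq_zero.1 ((ker τ i k).1 _ _ hmn)).resolve_right (by simpa using h)
  obtain ⟨d1, d2, d3⟩ := eq_of_sum_swapVec_mul_eq_zero hx hy (fun m => σ m m)
    fun τ i k => (ker τ i k).2
  have htr := hσ.2.1
  simp only [trace, diag_apply, Fintype.sum_prod_type, Fin.sum_univ_three] at htr
  rw [d1 0 1, d1 0 2, d1 1 1, d1 1 2, d1 2 1, d1 2 2] at htr
  have hs' := congrArg Complex.ofReal hsum
  have hd' := congrArg Complex.ofReal hdet
  have hy' : (b : ℂ) ≠ 0 := by simpa using hy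
  push_cast at hs' hd' d2 d3
  have hBC : b * σ (2, 0) (2, 0) = c * σ (1, 0) (1, 0) := by
    refine mul_left_cancel₀ hy' ?_
    linear_combination a / 3 * d2 - b / 3 * d3 - σ (1, 0) (1, 0) / 3 * hd'
  have hB : σ (1, 0) (1, 0) = b := by
    linear_combination b * htr - 3 * d2 - 3 * hBC - 3 * σ (1, 0) (1, 0) * hs'
  have hA : σ (0, 0) (0, 0) = a := by
    refine mul_left_cancel₀ hy' ?_
    linear_combination d2 + a * hB
  have hC : σ (2, 0) (2, 0) = c := by
    linear_combination htr / 3 - hA - hB - hs'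
  ext ⟨u, j⟩ n
  by_cases hmn : (u, j) = n
  · subst hmn
    rw [d1, diagonal_apply_eq]
    fin_cases u <;> simp [hA, hB, hC]
  · rw [off _ _ hmn, diagonal_apply_ne _ hmn]

/-- for 1/21 < c < 1/12, the state diag(a, a, a, b, b, b, c, c, c) with
a = (3 − 18c + √(3(−1+24c−36c²)))/18 and b = (3 − √(3(−1+24c−36c²)))/18
is extreme in AP_{3,3}. -/
theorem nu333_extreme (c : ℝ) (h1 : 1 / 21 < c) (h2 : c < 1 / 12) :
    diag9 ![(3 - 18 * c + Real.sqrt (3 * (-1 + 24 * c - 36 * c ^ 2))) / 18,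
        (3 - 18 * c + Real.sqrt (3 * (-1 + 24 * c - 36 * c ^ 2))) / 18,
        (3 - 18 * c + Real.sqrt (3 * (-1 + 24 * c - 36 * c ^ 2))) / 18,
        (3 - Real.sqrt (3 * (-1 + 24 * c - 36 * c ^ 2))) / 18,
        (3 - Real.sqrt (3 * (-1 + 24 * c - 36 * c ^ 2))) / 18,
        (3 - Real.sqrt (3 * (-1 + 24 * c - 36 * c ^ 2))) / 18, c, c, c]
      ∈ Set.extremePoints ℝ AP33 := by
  obtain ⟨hcb, hba, habc, hsum, hdet⟩ := eigenvalue_relations c h1 h2 _ _ rfl rfl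
  convert diagonal_mem_extremePoints (by linarith) hcb hba habc hsum hdet using 1
  rw [diag9, diagonal_eq_diagonal_iff]
  rintro ⟨i, j⟩
  rw [Complex.ofReal_inj]
  fin_cases i <;> fin_cases j <;> rfl
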